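/- Fix a real s > 1, an irrational ω = (ω₁, ω₂), and positive integers M, N with N ≥ 3M. Let T > 0 and let u : [0, T] → h^s(ℤ²) be infinitely differentiable as an h^s-valued map, solve the truncated resonant system at height N on [0, T], and be such that each coordinate function t ↦ u_k(t) is real-analytic on [0, T]. Assume u_k(0) = 0 for every k ∈ ℤ² \ Q_M. Then u_k(t) = 0 for every k ∈ ℤ² \ Q_M and every t ∈ [0, T]. -/

import Mathlib

open scoped ComplexConjugate

/-- `ω = (ω₁, ω₂)` is irrational: `ω₁m₁ + ω₂m₂ ≠ 0` for every nonzero `(m₁, m₂) ∈ ℤ²`. -/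
def IsIrrationalPair (ω : ℝ × ℝ) : Prop :=
  ∀ m : ℤ × ℤ, m ≠ 0 → ω.1 * (m.1 : ℝ) + ω.2 * (m.2 : ℝ) ≠ 0

/-- The frequency `λ_k = ω₁(k⁽¹⁾)² + ω₂(k⁽²⁾)²` for `k ∈ ℤ²`. -/
noncomputable def freq (ω : ℝ × ℝ) (k : ℤ × ℤ) : ℝ :=
  ω.1 * (k.1 : ℝ) ^ 2 + ω.2 * (k.2 : ℝ) ^ 2

/-- The squared Euclidean norm `|k|² = (k⁽¹⁾)² + (k⁽²⁾)²` of `k ∈ ℤ²`. -/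
def enormSq (k : ℤ × ℤ) : ℤ := k.1 ^ 2 + k.2 ^ 2

/-- The set `R^N(k)` of resonant triples at height `N`:
`(k₁, k₂, k₃)` with `(k₁, k₂, k₃, k) ∈ R` and `|k₁|, |k₂|, |k₃|, |k| ≤ N`. -/
def RNset (ω : ℝ × ℝ) (N : ℕ) (k : ℤ × ℤ) : Set ((ℤ × ℤ) × (ℤ × ℤ) × (ℤ × ℤ)) :=
  {p | p.1 + p.2.1 = p.2.2 + k ∧
    freq ω p.1 + freq ω p.2.1 = freq ω p.2.2 + freq ω k ∧
    enormSq p.1 ≤ (N : ℤ) ^ 2 ∧ enormSq p.2.1 ≤ (N : ℤ) ^ 2 ∧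
    enormSq p.2.2 ≤ (N : ℤ) ^ 2 ∧ enormSq k ≤ (N : ℤ) ^ 2}

/-- The set `W^N(k)` of weakly resonant triples at height `N`:
`k₁ + k₂ = k₃ + k`, `|λ_{k₁} + λ_{k₂} − λ_{k₃} − λ_k| ≤ 1`, and `|k₁| > N` or `|k₃| > N`. -/
def WNset (ω : ℝ × ℝ) (N : ℕ) (k : ℤ × ℤ) : Set ((ℤ × ℤ) × (ℤ × ℤ) × (ℤ × ℤ)) :=
  {p | p.1 + p.2.1 = p.2.2 + k ∧
    |freq ω p.1 + freq ω p.2.1 - freq ω p.2.2 - freq ω k| ≤ 1 ∧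
    ((N : ℤ) ^ 2 < enormSq p.1 ∨ (N : ℤ) ^ 2 < enormSq p.2.2)}

/-- The cubic monomial `x_{k₁} · x_{k₂} · conj(x_{k₃})` attached to a triple. -/
noncomputable def monom (x : ℤ × ℤ → ℂ) (p : (ℤ × ℤ) × (ℤ × ℤ) × (ℤ × ℤ)) : ℂ :=
  x p.1 * x p.2.1 * conj (x p.2.2)

/-- The oscillating factor `exp(i(λ_{k₁} + λ_{k₂} − λ_{k₃} − λ_k)t)`. -/
noncomputable def oscFactor (ω : ℝ × ℝ) (k : ℤ × ℤ)
    (p : (ℤ × ℤ) × (ℤ × ℤ) × (ℤ × ℤ)) (t : ℝ) : ℂ :=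
  Complex.exp (Complex.I *
    ((freq ω p.1 + freq ω p.2.1 - freq ω p.2.2 - freq ω k : ℝ) : ℂ) * (t : ℂ))

/-- `u` solves the truncated resonant system at height `N` on `[0, T]`: for each
`t ∈ [0, T]` and `k ∈ ℤ²`, both sums converge absolutely and
`i·(d/dt)u_k(t) = ∑_{R^N(k)} u_{k₁}u_{k₂}conj(u_{k₃})
 + ∑_{W^N(k)} u_{k₁}u_{k₂}conj(u_{k₃}) e^{i(λ_{k₁}+λ_{k₂}−λ_{k₃}−λ_k)t}`. -/
def SolvesTruncated (ω : ℝ × ℝ) (N : ℕ) (T : ℝ) (u : ℝ → (ℤ × ℤ) → ℂ) : Prop :=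
  ∀ t ∈ Set.Icc (0 : ℝ) T, ∀ k : ℤ × ℤ,
    Summable (fun p : RNset ω N k => ‖monom (u t) p.1‖) ∧
    Summable (fun p : WNset ω N k => ‖monom (u t) p.1‖) ∧
    HasDerivWithinAt (fun τ => u τ k)
      (-Complex.I * ((∑' p : RNset ω N k, monom (u t) p.1) +
        ∑' p : WNset ω N k, monom (u t) p.1 * oscFactor ω k p.1 t))
      (Set.Icc (0 : ℝ) T) t

/-- The Sobolev weight `(1 + |n|²)^s` for `n ∈ ℤ²`. -/
noncomputable def hsWeight (s : ℝ) (n : ℤ × ℤ) : ℝ :=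
  (1 + (n.1 : ℝ) ^ 2 + (n.2 : ℝ) ^ 2) ^ s

/-- Membership in `h^s(ℤ²)`: `∑ₙ |xₙ|² (1 + |n|²)^s < ∞`. -/
def InHs (s : ℝ) (x : ℤ × ℤ → ℂ) : Prop :=
  Summable (fun n : ℤ × ℤ => ‖x n‖ ^ 2 * hsWeight s n)

/-- The `h^s(ℤ²)` norm `‖x‖_s = (∑ₙ |xₙ|² (1 + |n|²)^s)^{1/2}`. -/
noncomputable def hsNorm (s : ℝ) (x : ℤ × ℤ → ℂ) : ℝ :=
  Real.sqrt (∑' n : ℤ × ℤ, ‖x n‖ ^ 2 * hsWeight s n)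

/-- Continuity of `u : [0, T] → h^s(ℤ²)` in the `h^s` norm. -/
def HsContOn (s T : ℝ) (u : ℝ → (ℤ × ℤ) → ℂ) : Prop :=
  ∀ t ∈ Set.Icc (0 : ℝ) T, ∀ ε > (0 : ℝ), ∃ δ > (0 : ℝ),
    ∀ t' ∈ Set.Icc (0 : ℝ) T, |t' - t| < δ →
      hsNorm s (fun k => u t' k - u t k) < ε

/-- `f' : [0, T] → h^s(ℤ²)` is the derivative of `f : [0, T] → h^s(ℤ²)` in the
`h^s` norm, at every point of `[0, T]`. -/
def HsDerivOn (s T : ℝ) (f f' : ℝ → (ℤ × ℤ) → ℂ) : Prop :=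
  ∀ t ∈ Set.Icc (0 : ℝ) T, ∀ ε > (0 : ℝ), ∃ δ > (0 : ℝ),
    ∀ t' ∈ Set.Icc (0 : ℝ) T, |t' - t| < δ →
      hsNorm s (fun k => f t' k - f t k - ((t' - t : ℝ) : ℂ) * f' t k) ≤ ε * |t' - t|

/-- The box `Q_M = {k ∈ ℤ² : max(|k⁽¹⁾|, |k⁽²⁾|) ≤ M}`. -/
def QBox (M : ℕ) : Set (ℤ × ℤ) := {k : ℤ × ℤ | max |k.1| |k.2| ≤ (M : ℤ)}

open Set Filter Topology

lemma hsWeight_pos (s : ℝ) (n : ℤ × ℤ) : 0 < hsWeight s n := by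
  unfold hsWeight; positivity

lemma summable_inv_hsWeight {s : ℝ} (hs : 1 < s) :
    Summable (fun n : ℤ × ℤ => (hsWeight s n)⁻¹) := by
  have h := EisensteinSeries.summable_one_div_norm_rpow (k := 2 * s) (by linarith)
  rw [← (finTwoArrowEquiv ℤ).symm.summable_iff] at h
  refine h.of_norm_bounded_eventually ?_
  filter_upwards [(Set.finite_singleton (0 : ℤ × ℤ)).compl_mem_cofinite] with n hn
  have hn0 : (finTwoArrowEquiv ℤ).symm n ≠ 0 := by
    intro h0
    apply hn
    have h1 := congrFun h0 0
    have h2 := congrFun h0 1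
    simp at h1 h2
    exact Prod.ext h1 h2
  have hpos : 0 < ‖(finTwoArrowEquiv ℤ).symm n‖ := norm_pos_iff.mpr hn0
  rw [Real.norm_of_nonneg (inv_nonneg.mpr (hsWeight_pos s n).le), Function.comp_apply,
    Real.rpow_neg hpos.le]
  refine inv_anti₀ (by positivity) ?_
  rw [Real.rpow_mul hpos.le, hsWeight]
  refine Real.rpow_le_rpow (by positivity) ?_ (by linarith)
  rw [Real.rpow_two]
  have hle : ‖(finTwoArrowEquiv ℤ).symm n‖ ≤ √(1 + (n.1 : ℝ) ^ 2 + (n.2 : ℝ) ^ 2) := by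
    refine (pi_norm_le_iff_of_nonneg (Real.sqrt_nonneg _)).mpr fun i => ?_
    refine Real.le_sqrt_of_sq_le ?_
    fin_cases i <;> simp [Int.norm_eq_abs] <;> nlinarith [sq_nonneg (n.1 : ℝ), sq_nonneg (n.2 : ℝ)]
  calc ‖(finTwoArrowEquiv ℤ).symm n‖ ^ 2 ≤ √(1 + (n.1 : ℝ) ^ 2 + (n.2 : ℝ) ^ 2) ^ 2 := by gcongr
    _ = _ := Real.sq_sqrt (by positivity)

/-- The constant of the embedding `h^s ⊆ ℓ¹` for `s > 1`. -/
noncomputable def embeddingConst (s : ℝ) : ℝ := √(∑' n : ℤ × ℤ, (hsWeight s n)⁻¹)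

lemma sum_norm_le_hsNorm {s : ℝ} (hs : 1 < s) {x : ℤ × ℤ → ℂ} (hx : InHs s x)
    (F : Finset (ℤ × ℤ)) : ∑ k ∈ F, ‖x k‖ ≤ embeddingConst s * hsNorm s x := by
  have hw := fun n => hsWeight_pos s n
  have h1 : ∑ k ∈ F, (hsWeight s k)⁻¹ ≤ ∑' n : ℤ × ℤ, (hsWeight s n)⁻¹ :=
    (summable_inv_hsWeight hs).sum_le_tsum F fun n _ => inv_nonneg.mpr (hw n).le
  have h2 : ∑ k ∈ F, ‖x k‖ ^ 2 * hsWeight s k ≤ ∑' n : ℤ × ℤ, ‖x n‖ ^ 2 * hsWeight s n :=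
    hx.sum_le_tsum F fun n _ => mul_nonneg (by positivity) (hw n).le
  have h3 := Finset.sum_sq_le_sum_mul_sum_of_sq_le_mul F (r := fun k => ‖x k‖)
    (f := fun k => (hsWeight s k)⁻¹) (g := fun k => ‖x k‖ ^ 2 * hsWeight s k)
    (fun k _ => inv_nonneg.mpr (hw k).le) (fun k _ => mul_nonneg (by positivity) (hw k).le)
    (fun k _ => by
      rw [mul_comm (‖x k‖ ^ 2), ← mul_assoc, inv_mul_cancel₀ (hw k).ne', one_mul])
  have h4 : 0 ≤ ∑ k ∈ F, ‖x k‖ ^ 2 * hsWeight s k :=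
    Finset.sum_nonneg fun k _ => mul_nonneg (by positivity) (hw k).le
  have h5 : 0 ≤ ∑' n : ℤ × ℤ, (hsWeight s n)⁻¹ := tsum_nonneg fun n => inv_nonneg.mpr (hw n).le
  rw [embeddingConst, hsNorm, ← Real.sqrt_mul h5]
  exact Real.le_sqrt_of_sq_le (h3.trans (mul_le_mul h1 h2 h4 h5))

lemma InHs.sub {s : ℝ} {x y : ℤ × ℤ → ℂ} (hx : InHs s x) (hy : InHs s y) :
    InHs s (fun k => x k - y k) := by
  refine Summable.of_nonneg_of_le (fun n => mul_nonneg (by positivity) (hsWeight_pos s n).le)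
    (fun n => ?_) ((hx.mul_left 2).add (hy.mul_left 2))
  have h1 : ‖x n - y n‖ ^ 2 ≤ 2 * ‖x n‖ ^ 2 + 2 * ‖y n‖ ^ 2 := by
    have := pow_le_pow_left₀ (norm_nonneg _) (norm_sub_le (x n) (y n)) 2
    nlinarith [sq_nonneg (‖x n‖ - ‖y n‖)]
  calc ‖x n - y n‖ ^ 2 * hsWeight s n
      ≤ (2 * ‖x n‖ ^ 2 + 2 * ‖y n‖ ^ 2) * hsWeight s n :=
        mul_le_mul_of_nonneg_right h1 (hsWeight_pos s n).le
    _ = _ := by ring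

lemma InHs.const_mul {s : ℝ} {x : ℤ × ℤ → ℂ} (hx : InHs s x) (c : ℂ) :
    InHs s (fun k => c * x k) := by
  refine (Summable.mul_left (‖c‖ ^ 2) hx).congr fun n => ?_
  rw [norm_mul]; ring

/-- An `h^s`-differentiable curve on `[0, T]` is bounded in `ℓ¹` when `s > 1`. -/
lemma exists_sum_norm_le {s T : ℝ} (hs : 1 < s) {f f' : ℝ → ℤ × ℤ → ℂ}
    (hf : ∀ t ∈ Icc (0 : ℝ) T, InHs s (f t)) (hf' : ∀ t ∈ Icc (0 : ℝ) T, InHs s (f' t))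
    (hd : HsDerivOn s T f f') :
    ∃ B : ℝ, ∀ t ∈ Icc (0 : ℝ) T, ∀ F : Finset (ℤ × ℤ), ∑ k ∈ F, ‖f t k‖ ≤ B := by
  have key : ∃ B : ℝ, ∀ t ∈ Icc (0 : ℝ) T, t ∈ Icc (0 : ℝ) T →
      ∀ F : Finset (ℤ × ℤ), ∑ k ∈ F, ‖f t k‖ ≤ B := by
    refine isCompact_Icc.induction_on
      (p := fun A => ∃ B : ℝ, ∀ t ∈ A, t ∈ Icc (0 : ℝ) T →
        ∀ F : Finset (ℤ × ℤ), ∑ k ∈ F, ‖f t k‖ ≤ B) ⟨0, by simp⟩ ?_ ?_ ?_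
    · rintro A A' hAA' ⟨B, hB⟩
      exact ⟨B, fun t ht => hB t (hAA' ht)⟩
    · rintro A A' ⟨B, hB⟩ ⟨B', hB'⟩
      refine ⟨max B B', fun t ht hT F => ?_⟩
      rcases ht with ht | ht
      · exact (hB t ht hT F).trans (le_max_left _ _)
      · exact (hB' t ht hT F).trans (le_max_right _ _)
    · intro t ht
      obtain ⟨δ, hδ, h⟩ := hd t ht 1 one_pos
      refine ⟨Metric.ball t δ, mem_nhdsWithin_of_mem_nhds (Metric.ball_mem_nhds t hδ),
        embeddingConst s * δ + embeddingConst s * hsNorm s (f t) +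
          δ * (embeddingConst s * hsNorm s (f' t)), fun t' ht' hT' F => ?_⟩
      have hδ' : |t' - t| < δ := by simpa [Real.dist_eq] using ht'
      have hr := sum_norm_le_hsNorm hs
        (((hf t' hT').sub (hf t ht)).sub ((hf' t ht).const_mul ((t' - t : ℝ) : ℂ))) F
      have h1 := sum_norm_le_hsNorm hs (hf t ht) F
      have h2 := sum_norm_le_hsNorm hs (hf' t ht) F
      have hK : 0 ≤ embeddingConst s := Real.sqrt_nonneg _
      have h3 : embeddingConst s * hsNorm s
          (fun k => f t' k - f t k - ((t' - t : ℝ) : ℂ) * f' t k) ≤ embeddingConst s * δ := by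
        refine mul_le_mul_of_nonneg_left ?_ hK
        linarith [h t' hT' hδ']
      have h4 : |t' - t| * ∑ k ∈ F, ‖f' t k‖ ≤ δ * (embeddingConst s * hsNorm s (f' t)) :=
        mul_le_mul hδ'.le h2 (Finset.sum_nonneg fun _ _ => norm_nonneg _) hδ.le
      have h5 : ∑ k ∈ F, ‖f t' k‖ ≤
          ∑ k ∈ F, ‖f t' k - f t k - ((t' - t : ℝ) : ℂ) * f' t k‖ + ∑ k ∈ F, ‖f t k‖ +
            |t' - t| * ∑ k ∈ F, ‖f' t k‖ := by
        rw [Finset.mul_sum, ← Finset.sum_add_distrib, ← Finset.sum_add_distrib]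
        refine Finset.sum_le_sum fun k _ => ?_
        have h6 : ‖((t' - t : ℝ) : ℂ) * f' t k‖ = |t' - t| * ‖f' t k‖ := by
          rw [norm_mul, Complex.norm_real, Real.norm_eq_abs]
        rw [← h6]
        calc ‖f t' k‖ = ‖(f t' k - f t k - ((t' - t : ℝ) : ℂ) * f' t k) + f t k +
              ((t' - t : ℝ) : ℂ) * f' t k‖ := by congr 1; ring
          _ ≤ _ := norm_add₃_le
      linarith
  obtain ⟨B, hB⟩ := key
  exact ⟨B, fun t ht => hB t ht ht⟩

lemma sum_tsum_le_of_pairwise_disjoint {ι α : Type*} {h : α → ℝ} {H : ℝ} (h0 : ∀ p, 0 ≤ h p)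
    (hh : HasSum h H) {S : ι → Set α} (hS : ∀ i j p, p ∈ S i → p ∈ S j → i = j)
    (F : Finset ι) : ∑ i ∈ F, ∑' p : S i, h p ≤ H := by
  classical
  simp_rw [tsum_subtype]
  rw [← Summable.tsum_finsetSum fun i _ => hh.summable.indicator _, ← hh.tsum_eq]
  refine Summable.tsum_le_tsum (fun p => ?_)
    (summable_sum fun i _ => hh.summable.indicator _) hh.summable
  by_cases hp : ∃ i ∈ F, p ∈ S i
  · obtain ⟨i, hi, hpi⟩ := hp
    rw [Finset.sum_eq_single_of_mem i hi fun j _ hji =>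
      indicator_of_notMem (fun hpj => hji (hS j i p hpj hpi)) h, indicator_of_mem hpi]
  · push Not at hp
    rw [Finset.sum_eq_zero fun i hi => indicator_of_notMem (hp i hi) h]
    exact h0 p

lemma hasSum_mul_mul {ι : Type*} {a b c : ι → ℝ} {A B C : ℝ} (ha : HasSum a A)
    (hb : HasSum b B) (hc : HasSum c C) (ha0 : ∀ i, 0 ≤ a i) (hb0 : ∀ i, 0 ≤ b i)
    (hc0 : ∀ i, 0 ≤ c i) :
    HasSum (fun p : ι × ι × ι => a p.1 * (b p.2.1 * c p.2.2)) (A * (B * C)) := by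
  have hbc : HasSum (fun q : ι × ι => b q.1 * c q.2) (B * C) :=
    hb.mul hc (hb.summable.mul_of_nonneg hc.summable hb0 hc0)
  exact ha.mul hbc (ha.summable.mul_of_nonneg hbc.summable ha0
    fun q => mul_nonneg (hb0 _) (hc0 _))

/-- Trilinear `ℓ¹` bound: if every admissible triple has an entry outside `Q`, the cubic sums
are controlled by the `ℓ¹` mass outside `Q`. -/
lemma sum_tsum_norm_monom_le {Q : Set (ℤ × ℤ)} {x : ℤ × ℤ → ℂ} {X Y : ℝ}
    (hX : HasSum (fun k => ‖x k‖) X) (hY : HasSum (Qᶜ.indicator fun k => ‖x k‖) Y)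
    {S : ℤ × ℤ → Set ((ℤ × ℤ) × (ℤ × ℤ) × (ℤ × ℤ))}
    (hS : ∀ k, ∀ p ∈ S k, p.1 + p.2.1 = p.2.2 + k) (F : Finset (ℤ × ℤ))
    (hF : ∀ k ∈ F, ∀ p ∈ S k, p.1 ∉ Q ∨ p.2.1 ∉ Q ∨ p.2.2 ∉ Q) :
    ∑ k ∈ F, ∑' p : S k, ‖monom x p.1‖ ≤ 3 * X ^ 2 * Y := by
  have hx0 : ∀ k, 0 ≤ ‖x k‖ := fun k => norm_nonneg _
  have hy0 : ∀ k, 0 ≤ Qᶜ.indicator (fun k => ‖x k‖) k := fun k =>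
    indicator_nonneg (fun k _ => hx0 k) k
  have hh := ((hasSum_mul_mul hY hX hX hy0 hx0 hx0).add (hasSum_mul_mul hX hY hX hx0 hy0 hx0)).add
    (hasSum_mul_mul hX hX hY hx0 hx0 hy0)
  have h0 : ∀ p : (ℤ × ℤ) × (ℤ × ℤ) × (ℤ × ℤ), 0 ≤
      Qᶜ.indicator (fun k => ‖x k‖) p.1 * (‖x p.2.1‖ * ‖x p.2.2‖) +
      ‖x p.1‖ * (Qᶜ.indicator (fun k => ‖x k‖) p.2.1 * ‖x p.2.2‖) +
      ‖x p.1‖ * (‖x p.2.1‖ * Qᶜ.indicator (fun k => ‖x k‖) p.2.2) := fun p =>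
    add_nonneg (add_nonneg (mul_nonneg (hy0 _) (mul_nonneg (hx0 _) (hx0 _)))
      (mul_nonneg (hx0 _) (mul_nonneg (hy0 _) (hx0 _))))
      (mul_nonneg (hx0 _) (mul_nonneg (hx0 _) (hy0 _)))
  have hle := sum_tsum_le_of_pairwise_disjoint h0 hh (S := S)
    (fun i j p hi hj => add_left_cancel ((hS i p hi).symm.trans (hS j p hj))) F
  calc ∑ k ∈ F, ∑' p : S k, ‖monom x p.1‖ ≤ _ := Finset.sum_le_sum fun k hk => ?_
    _ ≤ _ := hle
    _ = _ := by ring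
  have hbound : ∀ p : S k, ‖monom x p.1‖ ≤
      Qᶜ.indicator (fun k => ‖x k‖) p.1.1 * (‖x p.1.2.1‖ * ‖x p.1.2.2‖) +
      ‖x p.1.1‖ * (Qᶜ.indicator (fun k => ‖x k‖) p.1.2.1 * ‖x p.1.2.2‖) +
      ‖x p.1.1‖ * (‖x p.1.2.1‖ * Qᶜ.indicator (fun k => ‖x k‖) p.1.2.2) := by
    rintro ⟨p, hp⟩
    have e : ‖monom x p‖ = ‖x p.1‖ * (‖x p.2.1‖ * ‖x p.2.2‖) := by
      rw [monom, norm_mul, norm_mul, RCLike.norm_conj, mul_assoc]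
    have n1 := mul_nonneg (hy0 p.1) (mul_nonneg (hx0 p.2.1) (hx0 p.2.2))
    have n2 := mul_nonneg (hx0 p.1) (mul_nonneg (hy0 p.2.1) (hx0 p.2.2))
    have n3 := mul_nonneg (hx0 p.1) (mul_nonneg (hx0 p.2.1) (hy0 p.2.2))
    dsimp only
    rw [e]
    rcases hF k hk p hp with h | h | h
    · rw [indicator_of_mem (show p.1 ∈ Qᶜ from h)] at n1 ⊢
      linarith
    · rw [indicator_of_mem (show p.2.1 ∈ Qᶜ from h)] at n2 ⊢
      linarith
    · rw [indicator_of_mem (show p.2.2 ∈ Qᶜ from h)] at n3 ⊢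
      linarith
  have hs2 := hh.summable.subtype (S k)
  exact Summable.tsum_le_tsum hbound
    (hs2.of_nonneg_of_le (fun _ => norm_nonneg _) hbound) hs2

lemma exists_norm_le_one_mul_eq_norm (z : ℂ) : ∃ c : ℂ, ‖c‖ ≤ 1 ∧ c * z = (‖z‖ : ℂ) := by
  by_cases hz : z = 0
  · exact ⟨0, by simp, by simp [hz]⟩
  · have hz' : (‖z‖ : ℂ) ≠ 0 := by simpa using hz
    refine ⟨(‖z‖ : ℂ) / z, ?_, div_mul_cancel₀ _ hz⟩
    rw [norm_div, Complex.norm_real, norm_norm, div_self (by simpa using hz)]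

/-- Mean value inequality for finite `ℓ¹` sums. -/
lemma sum_norm_le_of_sum_norm_deriv_le {ι : Type*} {T : ℝ} {f f' : ι → ℝ → ℂ} {F : Finset ι}
    (hf : ∀ k ∈ F, ∀ t ∈ Icc (0 : ℝ) T, HasDerivWithinAt (f k) (f' k t) (Icc 0 T) t)
    (hf0 : ∀ k ∈ F, f k 0 = 0) {b b' : ℝ → ℝ} (hb : ∀ t, HasDerivAt b (b' t) t) (hb0 : b 0 = 0)
    (hle : ∀ t ∈ Icc (0 : ℝ) T, ∑ k ∈ F, ‖f' k t‖ ≤ b' t) :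
    ∀ t ∈ Icc (0 : ℝ) T, ∑ k ∈ F, ‖f k t‖ ≤ b t := by
  intro t ht
  choose c hc1 hc using fun k => exists_norm_le_one_mul_eq_norm (f k t)
  have hg : ∀ τ ∈ Icc (0 : ℝ) T, HasDerivWithinAt (fun τ => ∑ k ∈ F, c k * f k τ)
      (∑ k ∈ F, c k * f' k τ) (Icc 0 T) τ := fun τ hτ =>
    HasDerivWithinAt.fun_sum fun k hk => (hf k hk τ hτ).const_mul (c k)
  have hmain := image_norm_le_of_norm_deriv_right_le_deriv_boundary
    (f := fun τ => ∑ k ∈ F, c k * f k τ) (f' := fun τ => ∑ k ∈ F, c k * f' k τ)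
    (a := 0) (b := T) (B := b) (B' := b') (fun τ hτ => (hg τ hτ).continuousWithinAt)
    (fun τ hτ => (hg τ (Ico_subset_Icc_self hτ)).mono_of_mem_nhdsWithin
      (Icc_mem_nhdsGE_of_mem hτ))
    (by
      rw [hb0, Finset.sum_eq_zero fun k hk => by rw [hf0 k hk, mul_zero], norm_zero])
    hb
    (fun τ hτ => (norm_sum_le _ _).trans ((Finset.sum_le_sum fun k _ => by
      rw [norm_mul]
      exact mul_le_of_le_one_left (norm_nonneg _) (hc1 k)).trans
        (hle τ (Ico_subset_Icc_self hτ)))) ht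
  have he : ∑ k ∈ F, c k * f k t = ((∑ k ∈ F, ‖f k t‖ : ℝ) : ℂ) := by
    rw [Complex.ofReal_sum]
    exact Finset.sum_congr rfl fun k _ => hc k
  rw [he, Complex.norm_real, Real.norm_of_nonneg (Finset.sum_nonneg fun _ _ => norm_nonneg _)]
    at hmain
  exact hmain

lemma Int.eq_or_eq_of_add_eq_of_sq_add_sq_eq {a b c d : ℤ} (h1 : a + b = c + d)
    (h2 : a ^ 2 + b ^ 2 = c ^ 2 + d ^ 2) : d = a ∨ d = b := by
  have h : (d - a) * (d - b) = 0 := by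
    obtain rfl : c = a + b - d := by omega
    nlinarith
  rcases mul_eq_zero.mp h with h | h
  · left; omega
  · right; omega

/-- For irrational `ω` resonances are axis-parallel rectangles, so a resonant interaction of
modes of the box stays in the box. -/
lemma mem_QBox_of_resonant {ω : ℝ × ℝ} (hirr : IsIrrationalPair ω) {M : ℕ} {k₁ k₂ k₃ k : ℤ × ℤ}
    (hadd : k₁ + k₂ = k₃ + k) (hfreq : freq ω k₁ + freq ω k₂ = freq ω k₃ + freq ω k)
    (h₁ : k₁ ∈ QBox M) (h₂ : k₂ ∈ QBox M) : k ∈ QBox M := by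
  have hm : (k₁.1 ^ 2 + k₂.1 ^ 2 - k₃.1 ^ 2 - k.1 ^ 2, k₁.2 ^ 2 + k₂.2 ^ 2 - k₃.2 ^ 2 - k.2 ^ 2) =
      (0 : ℤ × ℤ) := by
    by_contra hne
    apply hirr _ hne
    simp only [freq] at hfreq
    push_cast
    linarith
  simp only [Prod.ext_iff, Prod.fst_add, Prod.snd_add, Prod.fst_zero, Prod.snd_zero] at hm hadd
  have e1 := Int.eq_or_eq_of_add_eq_of_sq_add_sq_eq hadd.1 (by linarith [hm.1])
  have e2 := Int.eq_or_eq_of_add_eq_of_sq_add_sq_eq hadd.2 (by linarith [hm.2])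
  simp only [QBox, mem_ofPred_eq, max_le_iff] at h₁ h₂ ⊢
  constructor
  · rcases e1 with e | e <;> rw [e]
    exacts [h₁.1, h₂.1]
  · rcases e2 with e | e <;> rw [e]
    exacts [h₁.2, h₂.2]

lemma notMem_QBox_of_lt_enormSq {M N : ℕ} (hMN : 3 * M ≤ N) {k : ℤ × ℤ}
    (h : (N : ℤ) ^ 2 < enormSq k) : k ∉ QBox M := by
  intro hk
  simp only [QBox, mem_ofPred_eq, max_le_iff] at hk
  have h1 : k.1 ^ 2 ≤ (M : ℤ) ^ 2 := sq_le_sq.mpr (by simpa using hk.1)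
  have h2 : k.2 ^ 2 ≤ (M : ℤ) ^ 2 := sq_le_sq.mpr (by simpa using hk.2)
  have h3 : (3 * (M : ℤ)) ^ 2 ≤ (N : ℤ) ^ 2 :=
    pow_le_pow_left₀ (by positivity) (by exact_mod_cast hMN) 2
  unfold enormSq at h
  nlinarith [sq_nonneg (M : ℤ)]

lemma norm_oscFactor (ω : ℝ × ℝ) (k : ℤ × ℤ) (p : (ℤ × ℤ) × (ℤ × ℤ) × (ℤ × ℤ)) (t : ℝ) :
    ‖oscFactor ω k p t‖ = 1 := by
  rw [oscFactor, mul_assoc, ← Complex.ofReal_mul, mul_comm]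
  exact Complex.norm_exp_ofReal_mul_I _

/-- The right-hand side of the truncated resonant system: the derivative of `u_k` at time `t`. -/
noncomputable def truncatedRHS (ω : ℝ × ℝ) (N : ℕ) (x : ℤ × ℤ → ℂ) (k : ℤ × ℤ) (t : ℝ) : ℂ :=
  -Complex.I * ((∑' p : RNset ω N k, monom x p.1) +
    ∑' p : WNset ω N k, monom x p.1 * oscFactor ω k p.1 t)

lemma sum_norm_truncatedRHS_le {ω : ℝ × ℝ} (hirr : IsIrrationalPair ω) {M N : ℕ}
    (hMN : 3 * M ≤ N) {x : ℤ × ℤ → ℂ} {X Y : ℝ} (hX : HasSum (fun k => ‖x k‖) X)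
    (hY : HasSum ((QBox M)ᶜ.indicator fun k => ‖x k‖) Y)
    (hR : ∀ k, Summable fun p : RNset ω N k => ‖monom x p.1‖)
    (hW : ∀ k, Summable fun p : WNset ω N k => ‖monom x p.1‖)
    {F : Finset (ℤ × ℤ)} (hF : ∀ k ∈ F, k ∉ QBox M) (t : ℝ) :
    ∑ k ∈ F, ‖truncatedRHS ω N x k t‖ ≤ 6 * X ^ 2 * Y := by
  have h1 := sum_tsum_norm_monom_le hX hY (S := RNset ω N) (fun k p hp => hp.1) F
    (fun k hk p hp => by
      by_contra! hcon
      exact hF k hk (mem_QBox_of_resonant hirr hp.1 hp.2.1 hcon.1 hcon.2.1))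
  have h2 := sum_tsum_norm_monom_le hX hY (S := WNset ω N) (fun k p hp => hp.1) F
    (fun k hk p hp => by
      rcases hp.2.2 with h | h
      · exact Or.inl (notMem_QBox_of_lt_enormSq hMN h)
      · exact Or.inr (Or.inr (notMem_QBox_of_lt_enormSq hMN h)))
  calc ∑ k ∈ F, ‖truncatedRHS ω N x k t‖
      ≤ ∑ k ∈ F, (∑' p : RNset ω N k, ‖monom x p.1‖ + ∑' p : WNset ω N k, ‖monom x p.1‖) := by
        refine Finset.sum_le_sum fun k _ => ?_
        rw [truncatedRHS, norm_mul, norm_neg, Complex.norm_I, one_mul]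
        have e : ∀ p : WNset ω N k, ‖monom x p.1 * oscFactor ω k p.1 t‖ = ‖monom x p.1‖ :=
          fun p => by rw [norm_mul, norm_oscFactor, mul_one]
        refine (norm_add_le _ _).trans (add_le_add (norm_tsum_le_tsum_norm (hR k)) ?_)
        refine (norm_tsum_le_tsum_norm ((hW k).congr fun p => (e p).symm)).trans_eq ?_
        exact tsum_congr e
    _ ≤ 6 * X ^ 2 * Y := by
        rw [Finset.sum_add_distrib]
        linarith

/-- Corollary 5.3 of the paper (stability of the support): if `u` is an infinitely
differentiable `h^s`-valued solution of the truncated resonant system at height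
`N ≥ 3M`, whose coordinates are real-analytic in time on `[0, T]`, and whose initial
datum is supported in `Q_M`, then the modes outside `Q_M` vanish for all `t ∈ [0, T]`.
The infinite `h^s`-differentiability is witnessed by the tower `D` of iterated
`h^s`-derivatives with `D 0 = u`. -/
theorem stmt_18 (s : ℝ) (hs : 1 < s) (ω : ℝ × ℝ) (hω1 : 0 < ω.1) (hω2 : 0 < ω.2)
    (hirr : IsIrrationalPair ω) (M N : ℕ) (hM : 0 < M) (hMN : 3 * M ≤ N)
    (T : ℝ) (hT : 0 < T) (u : ℝ → (ℤ × ℤ) → ℂ) (D : ℕ → ℝ → (ℤ × ℤ) → ℂ)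
    (hD0 : D 0 = u)
    (hDmem : ∀ n : ℕ, ∀ t ∈ Set.Icc (0 : ℝ) T, InHs s (D n t))
    (hDderiv : ∀ n : ℕ, HsDerivOn s T (D n) (D (n + 1)))
    (hsol : SolvesTruncated ω N T u)
    (hanalytic : ∀ k : ℤ × ℤ, ∀ t ∈ Set.Icc (0 : ℝ) T,
      AnalyticAt ℝ (fun τ => u τ k) t)
    (hsupp : ∀ k : ℤ × ℤ, k ∉ QBox M → u 0 k = 0) :
    ∀ k : ℤ × ℤ, k ∉ QBox M → ∀ t ∈ Set.Icc (0 : ℝ) T, u t k = 0 := by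
  have hu : ∀ t ∈ Icc (0 : ℝ) T, InHs s (u t) := fun t ht => hD0 ▸ hDmem 0 t ht
  obtain ⟨B, hB⟩ := exists_sum_norm_le hs hu (hDmem 1) (hD0 ▸ hDderiv 0)
  have hB0 : 0 ≤ B := by simpa using hB 0 ⟨le_rfl, hT.le⟩ ∅
  have hsum : ∀ t ∈ Icc (0 : ℝ) T, Summable fun k => ‖u t k‖ := fun t ht =>
    summable_of_sum_le (fun _ => norm_nonneg _) (hB t ht)
  have step : ∀ n : ℕ, ∀ F : Finset (ℤ × ℤ), (∀ k ∈ F, k ∉ QBox M) → ∀ t ∈ Icc (0 : ℝ) T,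
      ∑ k ∈ F, ‖u t k‖ ≤ B * ((6 * B ^ 2 * t) ^ n / n.factorial) := by
    intro n
    induction n with
    | zero => intro F _ t ht; simpa using hB t ht F
    | succ n ih =>
      intro F hF
      refine sum_norm_le_of_sum_norm_deriv_le (f := fun k t => u t k)
        (f' := fun k t => truncatedRHS ω N (u t) k t)
        (b := fun t => B * ((6 * B ^ 2 * t) ^ (n + 1) / (n + 1).factorial))
        (b' := fun t => 6 * B ^ 2 * (B * ((6 * B ^ 2 * t) ^ n / n.factorial)))
        (fun k _ t ht => (hsol t ht k).2.2) (fun k hk => hsupp k (hF k hk)) (fun t => ?_)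
        (by simp) (fun t ht => ?_)
      · have h := (((((hasDerivAt_id t).const_mul (6 * B ^ 2)).pow (n + 1)).div_const
          ((n + 1).factorial : ℝ))).const_mul B
        refine h.congr_deriv ?_
        have h1 : ((n : ℝ) + 1) ≠ 0 := by positivity
        have h2 : (n.factorial : ℝ) ≠ 0 := by positivity
        simp only [id, Nat.factorial_succ, add_tsub_cancel_right]
        push_cast
        field_simp
      · have hX := (hsum t ht).hasSum
        have hY := ((hsum t ht).indicator (QBox M)ᶜ).hasSum
        have hle := sum_norm_truncatedRHS_le hirr hMN hX hY (fun k => (hsol t ht k).1)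
          (fun k => (hsol t ht k).2.1) hF t
        refine hle.trans ?_
        have hXB : ∑' k, ‖u t k‖ ≤ B := (hsum t ht).tsum_le_of_sum_le (hB t ht)
        have hX0 : 0 ≤ ∑' k, ‖u t k‖ := tsum_nonneg fun _ => norm_nonneg _
        have hY0 : 0 ≤ ∑' k, (QBox M)ᶜ.indicator (fun k => ‖u t k‖) k :=
          tsum_nonneg fun k => indicator_nonneg (fun _ _ => norm_nonneg _) k
        have hYle : ∑' k, (QBox M)ᶜ.indicator (fun k => ‖u t k‖) k ≤
            B * ((6 * B ^ 2 * t) ^ n / n.factorial) := by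
          classical
          refine hY.summable.tsum_le_of_sum_le fun G => ?_
          simp only [indicator_apply]
          rw [← Finset.sum_filter]
          exact ih _ (fun k hk => (Finset.mem_filter.mp hk).2) t ht
        gcongr
  intro k hk t ht
  have hlim : Tendsto (fun n : ℕ => B * ((6 * B ^ 2 * t) ^ n / n.factorial)) atTop (𝓝 0) := by
    simpa using (FloorSemiring.tendsto_pow_div_factorial_atTop (6 * B ^ 2 * t)).const_mul B
  have hle : ‖u t k‖ ≤ 0 := ge_of_tendsto' hlim fun n => by
    simpa using step n {k} (by simpa using hk) t ht
  exact norm_le_zero_iff.mp hle
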